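/- Let F be a field of characteristic 2, let φ be an anisotropic quadratic form over F of dimension 5 and type (1,3) that is not a Pfister neighbour, and let ψ be an anisotropic quadratic form over F of type (2,s) with s ≥ 1. Then the scalar extension φ_{F(ψ)} of φ to the function field F(ψ) is anisotropic. -/

import Mathlib

open QuadraticMap MvPolynomial
open scoped TensorProduct

set_option synthInstance.maxHeartbeats 1000000
set_option maxHeartbeats 1000000


section Defs

variable {K : Type} [CommRing K]

/-- The binary quadratic form `[a,b] : (x,y) ↦ a·x² + x·y + b·y²`. -/
noncomputable def binQF (a b : K) : QuadraticForm K (Fin 2 → K) :=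
  (Matrix.of ![![a, 1], ![0, b]]).toQuadraticMap'

/-- The diagonal (totally singular) quadratic form `⟨c₁, …, c_s⟩`. -/
noncomputable def diagQF {s : ℕ} (c : Fin s → K) : QuadraticForm K (Fin s → K) :=
  QuadraticMap.weightedSumSquares K c

/-- The orthogonal sum `[a₁,b₁] ⊥ ⋯ ⊥ [a_r,b_r]` of binary forms. -/
noncomputable def binsQF {r : ℕ} (a b : Fin r → K) : QuadraticForm K (Fin r → Fin 2 → K) :=
  QuadraticMap.pi fun i => binQF (a i) (b i)

/-- The orthogonal sum of `m` hyperbolic planes `[0,0]`. -/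
noncomputable def hypQF (K : Type) [CommRing K] (m : ℕ) :
    QuadraticForm K (Fin m → Fin 2 → K) :=
  binsQF (fun _ => 0) (fun _ => 0)

/-- The `(n+1)`-fold quadratic Pfister form `⟨⟨a₁,…,aₙ⟩⟩_b ⊗ [1,c]`, i.e. the orthogonal
sum over all subsets `S ⊆ {1,…,n}` of `(∏_{i∈S} aᵢ)·[1,c]`. -/
noncomputable def pfisterQF (n : ℕ) (a : Fin n → K) (c : K) :
    QuadraticForm K (Finset (Fin n) → Fin 2 → K) :=
  QuadraticMap.pi fun S : Finset (Fin n) => (∏ i ∈ S, a i) • binQF 1 c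

variable {V W : Type} [AddCommGroup V] [Module K V] [AddCommGroup W] [Module K W]

/-- `φ` has type `(r,s)`: it is isometric to `[a₁,b₁] ⊥ ⋯ ⊥ [a_r,b_r] ⊥ ⟨c₁,…,c_s⟩`. -/
def HasTypeRS (φ : QuadraticForm K V) (r s : ℕ) : Prop :=
  ∃ (a b : Fin r → K) (c : Fin s → K), φ.Equivalent ((binsQF a b).prod (diagQF c))

/-- `φ` is dominated by `ψ`. -/
def Dominated (φ : QuadraticForm K V) (ψ : QuadraticForm K W) : Prop :=
  ∃ f : V →ₗ[K] W, Function.Injective f ∧ ∀ v, φ v = ψ (f v)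

/-- `φ` is weakly dominated by `ψ`: `α·φ` is dominated by `ψ` for some unit `α`. -/
def WeaklyDominated (φ : QuadraticForm K V) (ψ : QuadraticForm K W) : Prop :=
  ∃ α : Kˣ, Dominated ((α : K) • φ) ψ

/-- Witt equivalence of quadratic forms. -/
def WittEquiv (Q₁ : QuadraticForm K V) (Q₂ : QuadraticForm K W) : Prop :=
  ∃ k l : ℕ, (Q₁.prod (hypQF K k)).Equivalent (Q₂.prod (hypQF K l))

/-- `φ` is a Pfister neighbour: there is a quadratic Pfister form `π` with
`2·dim φ > dim π` and `φ ≺_w π`. -/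
def IsPfisterNeighbour (φ : QuadraticForm K V) : Prop :=
  ∃ (n : ℕ) (a : Fin n → Kˣ) (c : K),
    2 * Module.finrank K V > 2 ^ (n + 1) ∧
      WeaklyDominated φ (pfisterQF n (fun i => (a i : K)) c)

/-- The Artin–Schreier set `℘(K) = {t² + t : t ∈ K}`. -/
def ArtinSchreier (K : Type) [CommRing K] : Set K := {x : K | ∃ t : K, x = t ^ 2 + t}

end Defs

section FunField

variable (F : Type) [Field F]

/-- The coefficient matrix of a quadratic form on `Fin n → F` with respect to the
standard basis: diagonal entries `ψ(eᵢ)`, above-diagonal entries `b_ψ(eᵢ,eⱼ)`. -/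
noncomputable def coeffMat {n : ℕ} (ψ : QuadraticForm F (Fin n → F)) :
    Matrix (Fin n) (Fin n) F :=
  Matrix.of fun i j =>
    if i = j then ψ (Pi.single i 1)
    else if i < j then polar ψ (Pi.single i 1) (Pi.single j 1) else 0

/-- The homogeneous degree 2 polynomial `P_ψ` associated to a quadratic form `ψ`. -/
noncomputable def qfPoly {n : ℕ} (ψ : QuadraticForm F (Fin n → F)) :
    MvPolynomial (Fin n) F :=
  ∑ i : Fin n, ∑ j : Fin n, MvPolynomial.C (coeffMat F ψ i j) * (X i * X j)

/-- The affine coordinate ring `F[x₁,…,xₙ]/(P_ψ)` of the quadric `ψ = 0`. -/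
def FunFieldRing {n : ℕ} (ψ : QuadraticForm F (Fin n → F)) : Type :=
  MvPolynomial (Fin n) F ⧸ Ideal.span {qfPoly F ψ}

noncomputable instance {n : ℕ} (ψ : QuadraticForm F (Fin n → F)) :
    CommRing (FunFieldRing F ψ) :=
  inferInstanceAs (CommRing (MvPolynomial (Fin n) F ⧸ Ideal.span {qfPoly F ψ}))

noncomputable instance {n : ℕ} (ψ : QuadraticForm F (Fin n → F)) :
    Algebra F (FunFieldRing F ψ) :=
  inferInstanceAs (Algebra F (MvPolynomial (Fin n) F ⧸ Ideal.span {qfPoly F ψ}))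

/-- The function field `F(ψ)` of the quadric `ψ = 0`. -/
def FunField {n : ℕ} (ψ : QuadraticForm F (Fin n → F)) : Type :=
  FractionRing (FunFieldRing F ψ)

noncomputable instance {n : ℕ} (ψ : QuadraticForm F (Fin n → F)) :
    CommRing (FunField F ψ) :=
  inferInstanceAs (CommRing (FractionRing (FunFieldRing F ψ)))

noncomputable instance {n : ℕ} (ψ : QuadraticForm F (Fin n → F)) :
    Algebra (FunFieldRing F ψ) (FunField F ψ) :=
  inferInstanceAs (Algebra (FunFieldRing F ψ) (FractionRing (FunFieldRing F ψ)))

noncomputable instance {n : ℕ} (ψ : QuadraticForm F (Fin n → F)) :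
    Algebra F (FunField F ψ) :=
  inferInstanceAs (Algebra F (FractionRing (FunFieldRing F ψ)))

/-- The canonical map `F → F(ψ)`. -/
noncomputable def funFieldMap {n : ℕ} (ψ : QuadraticForm F (Fin n → F)) :
    F →+* FunField F ψ :=
  algebraMap F (FunField F ψ)

/-- Scalar extension of a quadratic form on `Fin n → F` along a ring homomorphism
`f : F → K`. -/
noncomputable def extendQF {K : Type} [CommRing K] (f : F →+* K) {n : ℕ}
    (φ : QuadraticForm F (Fin n → F)) : QuadraticForm K (Fin n → K) :=
  ((coeffMat F φ).map f).toQuadraticMap'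

end FunField


section Quat

variable (K : Type) [CommRing K]

/-- Defining relations for the char-2 quaternion algebra `[a,b)`: generators `i,j` with
`i² + i = a`, `j² = b`, `j·i = i·j + j` (i.e. `j·i·j⁻¹ = i + 1`). -/
inductive QuatRel (a b : K) : FreeAlgebra K (Fin 2) → FreeAlgebra K (Fin 2) → Prop
  | i_sq : QuatRel a b (FreeAlgebra.ι K 0 * FreeAlgebra.ι K 0 + FreeAlgebra.ι K 0)
      (algebraMap K _ a)
  | j_sq : QuatRel a b (FreeAlgebra.ι K 1 * FreeAlgebra.ι K 1) (algebraMap K _ b)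
  | swap : QuatRel a b (FreeAlgebra.ι K 1 * FreeAlgebra.ι K 0)
      (FreeAlgebra.ι K 0 * FreeAlgebra.ι K 1 + FreeAlgebra.ι K 1)

/-- The quaternion algebra `[a,b)` over `K` (characteristic two convention). -/
def QuatAlg (a b : K) : Type := RingQuot (QuatRel K a b)

noncomputable instance (a b : K) : Ring (QuatAlg K a b) :=
  inferInstanceAs (Ring (RingQuot (QuatRel K a b)))
noncomputable instance (a b : K) : Algebra K (QuatAlg K a b) :=
  inferInstanceAs (Algebra K (RingQuot (QuatRel K a b)))

/-- `[a,b)` is split over `K`: isomorphic to the `2×2` matrix algebra. -/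
def QuatSplit (a b : K) : Prop :=
  Nonempty (QuatAlg K a b ≃ₐ[K] Matrix (Fin 2) (Fin 2) K)

end Quat

section Sqrt

variable (F : Type) [Field F]

/-- The field `F(√c₁,…,√c_s)` obtained by adjoining square roots of the `cᵢ`
(inside an algebraic closure of `F`). -/
noncomputable def sqrtExt {s : ℕ} (c : Fin s → F) :
    IntermediateField F (AlgebraicClosure F) :=
  IntermediateField.adjoin F
    {y : AlgebraicClosure F | ∃ i, y ^ 2 = algebraMap F (AlgebraicClosure F) (c i)}

/-- The subfield `F² = {x² : x ∈ F}` of squares of a field of characteristic 2. -/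
noncomputable def sqSubfield : Subfield F := Subfield.closure (Set.range fun x : F => x ^ 2)

set_option synthInstance.maxHeartbeats 1000000 in
/-- The norm degree `[F²(cᵢ·cⱼ) : F²]` of a diagonal form `⟨c₁,…,c_s⟩`. -/
noncomputable def normDegree {s : ℕ} (c : Fin s → F) : ℕ :=
  Module.finrank (sqSubfield F)
    (IntermediateField.adjoin (sqSubfield F)
      (Set.range fun p : Fin s × Fin s => c p.1 * c p.2))

end Sqrt

/-- A ring is a division algebra if it is nontrivial and every nonzero element is a unit. -/
def IsDivisionAlgebra (T : Type) [Ring T] : Prop :=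
  (0 : T) ≠ 1 ∧ ∀ x : T, x ≠ 0 → IsUnit x

/-- The value `a X² + X Y + b Y² + Z²` of the ternary form `[a, b] ⊥ ⟨1⟩`. -/
def ternVal {R : Type*} [CommRing R] (a b X Y Z : R) : R :=
  a * X ^ 2 + X * Y + b * Y ^ 2 + Z ^ 2

/-- Anisotropy of the ternary form `[a, b] ⊥ ⟨1⟩` over a commutative ring. -/
def TernAniso {R : Type*} [CommRing R] (a b : R) : Prop :=
  ∀ X Y Z : R, ternVal a b X Y Z = 0 → X = 0 ∧ Y = 0 ∧ Z = 0

theorem map_ternVal {R S G : Type*} [CommRing R] [CommRing S] [FunLike G R S]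
    [RingHomClass G R S] (f : G) (a b X Y Z : R) :
    f (ternVal a b X Y Z) = ternVal (f a) (f b) (f X) (f Y) (f Z) := by
  simp [ternVal]

theorem ternVal_smul {R : Type*} [CommRing R] (a b t X Y Z : R) :
    ternVal a b (t * X) (t * Y) (t * Z) = t ^ 2 * ternVal a b X Y Z := by
  simp only [ternVal]; ring

theorem TernAniso.mvPolynomial {L σ : Type*} [Field L] [Infinite L] {a b : L}
    (h : TernAniso a b) : TernAniso (C a : MvPolynomial σ L) (C b) := by
  intro X Y Z hXYZ
  have key : ∀ v, eval v X = 0 ∧ eval v Y = 0 ∧ eval v Z = 0 := fun v => by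
    have := congrArg (eval v) hXYZ
    rw [map_ternVal] at this
    simpa using h _ _ _ (by simpa using this)
  refine ⟨MvPolynomial.funext fun v => ?_, MvPolynomial.funext fun v => ?_,
    MvPolynomial.funext fun v => ?_⟩
  · simpa using (key v).1
  · simpa using (key v).2.1
  · simpa using (key v).2.2

theorem TernAniso.polynomial {R : Type*} [CommRing R] [IsDomain R] [Infinite R] {a b : R}
    (h : TernAniso a b) : TernAniso (Polynomial.C a) (Polynomial.C b) := by
  intro X Y Z hXYZ
  have key : ∀ v, X.eval v = 0 ∧ Y.eval v = 0 ∧ Z.eval v = 0 := fun v => by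
    have := congrArg (Polynomial.evalRingHom v) hXYZ
    rw [map_ternVal] at this
    simpa using h _ _ _ (by simpa using this)
  refine ⟨Polynomial.funext fun v => ?_, Polynomial.funext fun v => ?_,
    Polynomial.funext fun v => ?_⟩
  · simpa using (key v).1
  · simpa using (key v).2.1
  · simpa using (key v).2.2

theorem exists_common_denom₃ {R : Type*} [CommRing R] [IsDomain R] (X Y Z : FractionRing R) :
    ∃ d x y z : R, d ≠ 0 ∧ algebraMap R _ d * X = algebraMap R _ x ∧
      algebraMap R _ d * Y = algebraMap R _ y ∧ algebraMap R _ d * Z = algebraMap R _ z := by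
  obtain ⟨d, hd⟩ := IsLocalization.exist_integer_multiples_of_finite (nonZeroDivisors R)
    (![X, Y, Z] : Fin 3 → FractionRing R)
  obtain ⟨x, hx⟩ := hd 0
  obtain ⟨y, hy⟩ := hd 1
  obtain ⟨z, hz⟩ := hd 2
  refine ⟨d, x, y, z, nonZeroDivisors.ne_zero d.2, ?_, ?_, ?_⟩
  · simpa [Algebra.smul_def, Submonoid.smul_def] using hx.symm
  · simpa [Algebra.smul_def, Submonoid.smul_def] using hy.symm
  · simpa [Algebra.smul_def, Submonoid.smul_def] using hz.symm

theorem TernAniso.fractionRing {R : Type*} [CommRing R] [IsDomain R] {a b : R}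
    (h : TernAniso a b) :
    TernAniso (algebraMap R (FractionRing R) a) (algebraMap R (FractionRing R) b) := by
  intro X Y Z hXYZ
  obtain ⟨d, x, y, z, hd, hx, hy, hz⟩ := exists_common_denom₃ X Y Z
  have hd' : algebraMap R (FractionRing R) d ≠ 0 := by simpa using hd
  have h0 := ternVal_smul (algebraMap R (FractionRing R) a) (algebraMap R _ b)
    (algebraMap R _ d) X Y Z
  rw [hXYZ, mul_zero, hx, hy, hz, ← map_ternVal] at h0
  obtain ⟨rfl, rfl, rfl⟩ := h x y z (by simpa using h0)
  simp only [map_zero, mul_eq_zero, hd', false_or] at hx hy hz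
  exact ⟨hx, hy, hz⟩

/-- The Cassels–Pfister theorem for the ternary form `[a, b] ⊥ ⟨1⟩`. -/
theorem cassels_pfister_tern {K : Type*} [Field K] [Infinite K] {a b : K} (hab : TernAniso a b)
    (f : Polynomial K) (h : Polynomial K) (hh : h ≠ 0) (p₁ p₂ p₃ : Polynomial K)
    (hp : ternVal (Polynomial.C a) (Polynomial.C b) p₁ p₂ p₃ = h ^ 2 * f) :
    ∃ u₁ u₂ u₃, ternVal (Polynomial.C a) (Polynomial.C b) u₁ u₂ u₃ = f := by
  induction hn : h.natDegree using Nat.strong_induction_on generalizing h p₁ p₂ p₃ with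
  | _ n ih =>
  set A := Polynomial.C a with hA
  set B := Polynomial.C b with hB
  obtain ⟨u₁, r₁, e₁, d₁⟩ : ∃ u r, p₁ = h * u + r ∧ r.degree < h.degree :=
    ⟨p₁ / h, p₁ % h, (EuclideanDomain.div_add_mod p₁ h).symm, EuclideanDomain.mod_lt _ hh⟩
  obtain ⟨u₂, r₂, e₂, d₂⟩ : ∃ u r, p₂ = h * u + r ∧ r.degree < h.degree :=
    ⟨p₂ / h, p₂ % h, (EuclideanDomain.div_add_mod p₂ h).symm, EuclideanDomain.mod_lt _ hh⟩
  obtain ⟨u₃, r₃, e₃, d₃⟩ : ∃ u r, p₃ = h * u + r ∧ r.degree < h.degree :=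
    ⟨p₃ / h, p₃ % h, (EuclideanDomain.div_add_mod p₃ h).symm, EuclideanDomain.mod_lt _ hh⟩
  by_cases hr : r₁ = 0 ∧ r₂ = 0 ∧ r₃ = 0
  · obtain ⟨rfl, rfl, rfl⟩ := hr
    refine ⟨u₁, u₂, u₃, mul_left_cancel₀ (pow_ne_zero 2 hh) ?_⟩
    rw [← hp, e₁, e₂, e₃]
    simp only [ternVal]; ring
  have hρ : ternVal A B r₁ r₂ r₃ ≠ 0 := fun h0 => hr (hab.polynomial _ _ _ h0)
  set q := ternVal A B u₁ u₂ u₃ with hq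
  set h' := h * f + h * q - (2 * A * p₁ * u₁ + (p₁ * u₂ + p₂ * u₁) + 2 * B * p₂ * u₂
    + 2 * p₃ * u₃) with hh'
  have hmul : ternVal A B r₁ r₂ r₃ = h * h' := by
    have : h * h' = h ^ 2 * f + h ^ 2 * q - h * (2 * A * p₁ * u₁ + (p₁ * u₂ + p₂ * u₁)
      + 2 * B * p₂ * u₂ + 2 * p₃ * u₃) := by rw [hh']; ring
    rw [this, ← hp, hq, e₁, e₂, e₃]
    simp only [ternVal]; ring
  have h'0 : h' ≠ 0 := fun h0 => hρ (by rw [hmul, h0, mul_zero])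
  have hdeg : h'.natDegree < n := by
    have nd : ∀ r : Polynomial K, r.degree < h.degree → r.natDegree ≤ n - 1 ∧ (r ≠ 0 → 0 < n) := by
      intro r hr
      by_cases hr0 : r = 0
      · simp [hr0]
      · have := Polynomial.natDegree_lt_natDegree hr0 hr
        exact ⟨by omega, fun _ => by omega⟩
    have hn0 : 0 < n := by
      by_contra hcon
      refine hr ⟨?_, ?_, ?_⟩
      · by_contra h0; exact hcon ((nd _ d₁).2 h0)
      · by_contra h0; exact hcon ((nd _ d₂).2 h0)
      · by_contra h0; exact hcon ((nd _ d₃).2 h0)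
    have l₁ := (nd _ d₁).1
    have l₂ := (nd _ d₂).1
    have l₃ := (nd _ d₃).1
    have hle : (ternVal A B r₁ r₂ r₃).natDegree ≤ 2 * (n - 1) := by
      simp only [ternVal]
      refine Polynomial.natDegree_add_le_of_degree_le (Polynomial.natDegree_add_le_of_degree_le
        (Polynomial.natDegree_add_le_of_degree_le ?_ ?_) ?_) ?_
      · exact (Polynomial.natDegree_C_mul_le _ _).trans
          (Polynomial.natDegree_pow_le_of_le 2 l₁)
      · exact (Polynomial.natDegree_mul_le_of_le l₁ l₂).trans (by omega)
      · exact (Polynomial.natDegree_C_mul_le _ _).trans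
          (Polynomial.natDegree_pow_le_of_le 2 l₂)
      · exact Polynomial.natDegree_pow_le_of_le 2 l₃
    rw [hmul, Polynomial.natDegree_mul hh h'0, hn] at hle
    omega
  refine ih _ hdeg h' h'0 (h' * u₁ + (q - f) * r₁) (h' * u₂ + (q - f) * r₂)
    (h' * u₃ + (q - f) * r₃) ?_ rfl
  have expand : ternVal A B (h' * u₁ + (q - f) * r₁) (h' * u₂ + (q - f) * r₂)
      (h' * u₃ + (q - f) * r₃) = h' ^ 2 * q + (q - f) * h' *
        (2 * A * u₁ * r₁ + (u₁ * r₂ + u₂ * r₁) + 2 * B * u₂ * r₂ + 2 * u₃ * r₃)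
        + (q - f) ^ 2 * ternVal A B r₁ r₂ r₃ := by
    rw [hq]; simp only [ternVal]; ring
  have hbil : 2 * A * u₁ * r₁ + (u₁ * r₂ + u₂ * r₁) + 2 * B * u₂ * r₂ + 2 * u₃ * r₃
      = h * f - h * q - h' := by
    rw [hh', e₁, e₂, e₃, hq]; simp only [ternVal]; ring
  rw [expand, hbil, hmul]
  ring

theorem natDegree_le_one_of_ternVal {K : Type*} [Field K] {a b : K} (hab : TernAniso a b)
    (u₁ u₂ u₃ : Polynomial K)
    (hu : (ternVal (Polynomial.C a) (Polynomial.C b) u₁ u₂ u₃).natDegree ≤ 2) :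
    u₁.natDegree ≤ 1 ∧ u₂.natDegree ≤ 1 ∧ u₃.natDegree ≤ 1 := by
  have step : ∀ m, u₁.natDegree ≤ m + 1 ∧ u₂.natDegree ≤ m + 1 ∧ u₃.natDegree ≤ m + 1 →
      u₁.natDegree ≤ 1 ∧ u₂.natDegree ≤ 1 ∧ u₃.natDegree ≤ 1 := by
    intro m
    induction m with
    | zero => simp
    | succ m ih =>
      rintro ⟨h₁, h₂, h₃⟩
      have hc : (ternVal (Polynomial.C a) (Polynomial.C b) u₁ u₂ u₃).coeff
          (2 * (m + 1 + 1)) = 0 :=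
        Polynomial.coeff_eq_zero_of_natDegree_lt (by omega)
      have e : (u₁ * u₂).coeff (2 * (m + 1 + 1)) = u₁.coeff (m + 1 + 1) * u₂.coeff (m + 1 + 1) := by
        rw [two_mul, Polynomial.coeff_mul_add_eq_of_natDegree_le h₁ h₂]
      simp only [ternVal, Polynomial.coeff_add, Polynomial.coeff_C_mul, e,
        Polynomial.coeff_pow_of_natDegree_le h₁, Polynomial.coeff_pow_of_natDegree_le h₂,
        Polynomial.coeff_pow_of_natDegree_le h₃] at hc
      obtain ⟨z₁, z₂, z₃⟩ := hab _ _ _ hc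
      have drop : ∀ u : Polynomial K, u.natDegree ≤ m + 1 + 1 → u.coeff (m + 1 + 1) = 0 →
          u.natDegree ≤ m + 1 := fun u hu h0 =>
        (Polynomial.natDegree_le_iff_coeff_eq_zero).2 fun k hk => by
          rcases Nat.lt_or_ge (m + 1 + 1) k with h | h
          · exact Polynomial.coeff_eq_zero_of_natDegree_lt (hu.trans_lt h)
          · obtain rfl : k = m + 1 + 1 := by omega
            exact h0
      exact ih ⟨drop _ h₁ z₁, drop _ h₂ z₂, drop _ h₃ z₃⟩
  exact step (u₁.natDegree + u₂.natDegree + u₃.natDegree) ⟨by omega, by omega, by omega⟩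

theorem exists_ternVal_constant_coeff {R : Type*} [CommRing R] [IsDomain R] {a b : R}
    (hab : TernAniso a b) (δ h : Polynomial R) (hh : h ≠ 0) (U₁ U₂ U₃ : Polynomial R)
    (hU : ternVal (Polynomial.C a) (Polynomial.C b) U₁ U₂ U₃ = h ^ 2 * δ) :
    ∃ k V₁ V₂ V₃ : R, k ≠ 0 ∧ ternVal a b V₁ V₂ V₃ = k ^ 2 * δ.eval 0 := by
  induction hn : h.natDegree using Nat.strong_induction_on generalizing h U₁ U₂ U₃ with
  | _ n ih =>
  have h0 := congrArg (Polynomial.evalRingHom 0) hU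
  rw [map_ternVal] at h0
  simp only [Polynomial.coe_evalRingHom, Polynomial.eval_C, Polynomial.eval_mul,
    Polynomial.eval_pow] at h0
  by_cases hz : h.eval 0 = 0
  · rw [hz, zero_pow two_ne_zero, zero_mul] at h0
    obtain ⟨z₁, z₂, z₃⟩ := hab _ _ _ h0
    have dv : ∀ p : Polynomial R, p.eval 0 = 0 → ∃ q, p = Polynomial.X * q := fun p hp =>
      Polynomial.X_dvd_iff.2 (by rw [Polynomial.coeff_zero_eq_eval_zero, hp])
    obtain ⟨k, rfl⟩ := dv _ hz
    obtain ⟨V₁, rfl⟩ := dv _ z₁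
    obtain ⟨V₂, rfl⟩ := dv _ z₂
    obtain ⟨V₃, rfl⟩ := dv _ z₃
    have hk : k ≠ 0 := right_ne_zero_of_mul hh
    refine ih k.natDegree ?_ k hk V₁ V₂ V₃ ?_ rfl
    · rw [← hn, Polynomial.natDegree_X_mul hk]; exact Nat.lt_succ_self _
    · rw [ternVal_smul] at hU
      refine mul_left_cancel₀ (pow_ne_zero 2 (Polynomial.X_ne_zero (R := R))) ?_
      rw [hU]; ring
  · exact ⟨_, _, _, _, hz, h0⟩

theorem exists_ternVal_of_orthogonal_pair {R : Type*} [CommRing R] [IsDomain R] [CharP R 2]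
    {a b : R} (hab : TernAniso a b) (δ X₀ Y₀ Z₀ X₁ Y₁ Z₁ : R)
    (hne : ¬ (X₀ = 0 ∧ Y₀ = 0 ∧ Z₀ = 0 ∧ X₁ = 0 ∧ Y₁ = 0 ∧ Z₁ = 0))
    (hval : ternVal a b X₀ Y₀ Z₀ = δ * ternVal a b X₁ Y₁ Z₁)
    (hpol : X₀ * Y₁ = X₁ * Y₀) :
    ∃ h U₁ U₂ U₃ : R, h ≠ 0 ∧ ternVal a b U₁ U₂ U₃ = h ^ 2 * δ := by
  have h2 : (2 : R) = 0 := CharTwo.two_eq_zero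
  have hne₁ : ternVal a b X₁ Y₁ Z₁ ≠ 0 := fun h0 => by
    rw [h0, mul_zero] at hval
    obtain ⟨rfl, rfl, rfl⟩ := hab _ _ _ hval
    obtain ⟨rfl, rfl, rfl⟩ := hab _ _ _ h0
    exact hne ⟨rfl, rfl, rfl, rfl, rfl, rfl⟩
  set r := ternVal a b X₁ Y₁ Z₁ with hr
  -- `t R₀ = t₀ R₁ + (0, 0, ν)` with `t ≠ 0` a coordinate of `R₁`
  have key : ∀ t t₀ : R, t ≠ 0 → t * X₀ = t₀ * X₁ → t * Y₀ = t₀ * Y₁ →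
      ∃ h U₁ U₂ U₃ : R, h ≠ 0 ∧ ternVal a b U₁ U₂ U₃ = h ^ 2 * δ := by
    intro t t₀ ht hX hY
    set ν := t * Z₀ + t₀ * Z₁ with hν
    have e₁ : t ^ 2 * (δ * r) = t₀ ^ 2 * r + ν ^ 2 := by
      rw [← hval, ← ternVal_smul, hX, hY, hr, ← ternVal_smul, hν]
      simp only [ternVal]
      linear_combination (-t * Z₀ * t₀ * Z₁ - t₀ ^ 2 * Z₁ ^ 2) * h2
    refine ⟨r * t, ν * X₁, ν * Y₁, ν * Z₁ + r * t₀, mul_ne_zero hne₁ ht, ?_⟩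
    have e₂ : ternVal a b (ν * X₁) (ν * Y₁) (ν * Z₁ + r * t₀) = ν ^ 2 * r + (r * t₀) ^ 2 := by
      have : ∀ w, ternVal a b (ν * X₁) (ν * Y₁) (ν * Z₁ + w) =
          ternVal a b (ν * X₁) (ν * Y₁) (ν * Z₁) + w ^ 2 := fun w => by
        simp only [ternVal]
        linear_combination (ν * Z₁ * w) * h2
      rw [this, ternVal_smul]
    rw [e₂]
    linear_combination (-r) * e₁
  by_cases hX : X₁ = 0
  · by_cases hY : Y₁ = 0
    · subst hX hY
      have hZ : Z₁ ≠ 0 := by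
        rintro rfl; exact hne₁ (by simp [hr, ternVal])
      exact ⟨Z₁, X₀, Y₀, Z₀, hZ, by rw [hval, hr]; simp only [ternVal]; ring⟩
    · exact key Y₁ Y₀ hY (by linear_combination hpol) (mul_comm _ _)
  · exact key X₁ X₀ hX (mul_comm _ _) (by linear_combination -hpol)

theorem pderiv_sq {L σ : Type*} [CommRing L] [CharP L 2] (i : σ) (p : MvPolynomial σ L) :
    pderiv i (p ^ 2) = 0 := by
  rw [pow_two, Derivation.leibniz, CharTwo.add_self_eq_zero]

/-- The ternary form `[a, b] ⊥ ⟨1⟩` cannot represent the generic value of `⟨A⟩ ⊥ c` if `A` is not a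
square and `c` has a nonzero partial derivative. -/
theorem no_ternVal_generic {L σ : Type*} [Field L] [Infinite L] [CharP L 2] {a b A : L}
    (hab : TernAniso a b) (hA : ¬ IsSquare A) (c : MvPolynomial σ L) (i : σ)
    (hc : pderiv i c ≠ 0) (h U₁ U₂ U₃ : Polynomial (MvPolynomial σ L)) (hh : h ≠ 0)
    (hU : ternVal (Polynomial.C (C a)) (Polynomial.C (C b)) U₁ U₂ U₃ =
      h ^ 2 * (Polynomial.C (C A) * Polynomial.X ^ 2 + Polynomial.C c)) : False := by
  let K := FractionRing (MvPolynomial σ L)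
  let ι : MvPolynomial σ L →+* K := algebraMap _ K
  have hι : Function.Injective ι := IsFractionRing.injective _ _
  have hIK : Infinite K := Infinite.of_injective ι hι
  have h2 : (2 : K) = 0 := by
    have : (2 : K) = ι 2 := (map_ofNat ι 2).symm
    rw [this, show (2 : MvPolynomial σ L) = 0 from CharTwo.two_eq_zero, map_zero]
  have hK : TernAniso (ι (C a)) (ι (C b)) := (hab.mvPolynomial (σ := σ)).fractionRing
  have hU' := congrArg (Polynomial.mapRingHom ι) hU
  rw [map_ternVal] at hU'
  simp only [map_mul, map_pow, map_add, Polynomial.coe_mapRingHom, Polynomial.map_C,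
    Polynomial.map_X] at hU'
  obtain ⟨u₁, u₂, u₃, hu⟩ := cassels_pfister_tern hK _ _
    ((Polynomial.map_ne_zero_iff hι).2 hh) _ _ _ hU'
  have hdeg : (ternVal (Polynomial.C (ι (C a))) (Polynomial.C (ι (C b))) u₁ u₂ u₃).natDegree
      ≤ 2 := by rw [hu]; compute_degree
  obtain ⟨d₁, d₂, d₃⟩ := natDegree_le_one_of_ternVal hK _ _ _ hdeg
  obtain ⟨p₁, q₁, rfl⟩ := Polynomial.exists_eq_X_add_C_of_natDegree_le_one d₁
  obtain ⟨p₂, q₂, rfl⟩ := Polynomial.exists_eq_X_add_C_of_natDegree_le_one d₂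
  obtain ⟨p₃, q₃, rfl⟩ := Polynomial.exists_eq_X_add_C_of_natDegree_le_one d₃
  have hquad : Polynomial.C (ternVal (ι (C a)) (ι (C b)) p₁ p₂ p₃) * Polynomial.X ^ 2 +
      Polynomial.C (p₁ * q₂ + p₂ * q₁) * Polynomial.X +
      Polynomial.C (ternVal (ι (C a)) (ι (C b)) q₁ q₂ q₃) =
      Polynomial.C (ι (C A)) * Polynomial.X ^ 2 + Polynomial.C 0 * Polynomial.X +
        Polynomial.C (ι c) := by
    have h2' : (2 : Polynomial K) = 0 := by
      rw [show (2 : Polynomial K) = Polynomial.C 2 from (map_ofNat Polynomial.C 2).symm, h2,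
        map_zero]
    rw [map_zero, zero_mul, add_zero, ← hu]
    simp only [ternVal, map_add, map_mul, map_pow]
    linear_combination (-Polynomial.C (ι (C a)) * Polynomial.C p₁ * Polynomial.C q₁ * Polynomial.X
      - Polynomial.C (ι (C b)) * Polynomial.C p₂ * Polynomial.C q₂ * Polynomial.X
      - Polynomial.C p₃ * Polynomial.C q₃ * Polynomial.X) * h2'
  have c0 := congrArg (fun p => Polynomial.coeff p 0) hquad
  have c1 := congrArg (fun p => Polynomial.coeff p 1) hquad
  have c2 := congrArg (fun p => Polynomial.coeff p 2) hquad
  simp [Polynomial.coeff_X, Polynomial.coeff_C, Polynomial.coeff_X_pow] at c0 c1 c2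
  have key : ∃ α : K, q₁ = α * p₁ ∧ q₂ = α * p₂ := by
    by_cases hp₁ : p₁ = 0
    · by_cases hp₂ : p₂ = 0
      · subst hp₁ hp₂
        exfalso
        obtain ⟨d, x, -, -, hd, hx, -, -⟩ := exists_common_denom₃ (R := MvPolynomial σ L) p₃ 0 0
        have e : C A * d ^ 2 = x ^ 2 := hι (by
          simp only [map_mul, map_pow]
          rw [← c2, show ι x = ι d * p₃ from hx.symm]
          simp only [ternVal]; ring)
        have : ∃ v, eval v d ≠ 0 := by
          by_contra! hcon
          exact hd (MvPolynomial.funext fun v => by simp [hcon])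
        obtain ⟨v, hv⟩ := this
        have e' := congrArg (eval v) e
        simp only [map_mul, map_pow, eval_C] at e'
        refine hA ⟨eval v x / eval v d, ?_⟩
        field_simp
        exact e'
      · refine ⟨q₂ / p₂, ?_, (div_mul_cancel₀ _ hp₂).symm⟩
        rw [div_mul_eq_mul_div, eq_div_iff hp₂]
        linear_combination c1 - p₁ * q₂ * h2
    · refine ⟨q₁ / p₁, (div_mul_cancel₀ _ hp₁).symm, ?_⟩
      rw [div_mul_eq_mul_div, eq_div_iff hp₁]
      linear_combination c1 - p₂ * q₁ * h2
  obtain ⟨α, rfl, rfl⟩ := key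
  obtain ⟨d, x, y, -, hd, hx, hy, -⟩ := exists_common_denom₃ (R := MvPolynomial σ L) α
    (q₃ + α * p₃) 0
  have e : c * d ^ 2 = C A * x ^ 2 + y ^ 2 := hι (by
    simp only [map_mul, map_pow, map_add]
    rw [← c0, ← c2, show ι x = ι d * α from hx.symm, show ι y = ι d * (q₃ + α * p₃) from hy.symm]
    simp only [ternVal]
    linear_combination -(ι d ^ 2) * (α ^ 2 * p₃ ^ 2 + q₃ * α * p₃) * h2)
  have e' := congrArg (pderiv i) e
  simp only [Derivation.leibniz, map_add, pderiv_sq, pderiv_C, zero_add, add_zero,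
    smul_eq_mul, mul_zero, mul_eq_zero, pow_eq_zero_iff two_ne_zero] at e'
  exact e'.elim hd hc

/-- The subfield `F²(γ₂, γ₃)` of a field `F` of characteristic two. -/
def sqAdjoin {F : Type*} [Field F] [CharP F 2] (γ₂ γ₃ : F) : Subfield F where
  carrier := {n | ∃ p q r s : F, n = p ^ 2 + γ₂ * q ^ 2 + γ₃ * r ^ 2 + γ₂ * γ₃ * s ^ 2}
  zero_mem' := ⟨0, 0, 0, 0, by ring⟩
  one_mem' := ⟨1, 0, 0, 0, by ring⟩
  neg_mem' := by
    rintro _ ⟨p, q, r, s, rfl⟩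
    exact ⟨p, q, r, s, CharTwo.neg_eq _⟩
  add_mem' := by
    rintro _ _ ⟨p, q, r, s, rfl⟩ ⟨p', q', r', s', rfl⟩
    exact ⟨p + p', q + q', r + r', s + s', by simp only [CharTwo.add_sq]; ring⟩
  mul_mem' := by
    rintro _ _ ⟨p, q, r, s, rfl⟩ ⟨p', q', r', s', rfl⟩
    exact ⟨p * p' + γ₂ * q * q' + γ₃ * r * r' + γ₂ * γ₃ * s * s',
      p * q' + q * p' + γ₃ * r * s' + γ₃ * s * r', p * r' + r * p' + γ₂ * q * s' + γ₂ * s * q',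
      p * s' + s * p' + q * r' + r * q', by simp only [CharTwo.add_sq]; ring⟩
  inv_mem' := by
    rintro n ⟨p, q, r, s, h⟩
    by_cases hn : n = 0
    · exact ⟨0, 0, 0, 0, by rw [hn, inv_zero]; ring⟩
    · refine ⟨p / n, q / n, r / n, s / n, ?_⟩
      field_simp
      exact h

theorem sq_mem_sqAdjoin {F : Type*} [Field F] [CharP F 2] (γ₂ γ₃ x : F) :
    x ^ 2 ∈ sqAdjoin γ₂ γ₃ := ⟨x, 0, 0, 0, by ring⟩

theorem left_mem_sqAdjoin {F : Type*} [Field F] [CharP F 2] (γ₂ γ₃ : F) :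
    γ₂ ∈ sqAdjoin γ₂ γ₃ := ⟨0, 1, 0, 0, by ring⟩

theorem right_mem_sqAdjoin {F : Type*} [Field F] [CharP F 2] (γ₂ γ₃ : F) :
    γ₃ ∈ sqAdjoin γ₂ γ₃ := ⟨0, 0, 1, 0, by ring⟩

/-- The Frobenius map of `F` with values in `F²(γ₂, γ₃)`. It is isomorphic to the inclusion
`F ⊆ F(√γ₂, √γ₃)`. -/
def frobSqAdjoin {F : Type*} [Field F] [CharP F 2] (γ₂ γ₃ : F) : F →+* sqAdjoin γ₂ γ₃ where
  toFun x := ⟨x ^ 2, sq_mem_sqAdjoin _ _ x⟩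
  map_one' := Subtype.ext (one_pow 2)
  map_zero' := Subtype.ext (zero_pow two_ne_zero)
  map_add' x y := Subtype.ext (CharTwo.add_sq x y)
  map_mul' x y := Subtype.ext (mul_pow x y 2)

/-- The value of the form `[a, b] ⊥ ⟨1, γ₂, γ₃⟩`. -/
def quinVal {R : Type*} [CommRing R] (a b γ₂ γ₃ : R) (v : Fin 5 → R) : R :=
  a * v 0 ^ 2 + v 0 * v 1 + b * v 1 ^ 2 + v 2 ^ 2 + γ₂ * v 3 ^ 2 + γ₃ * v 4 ^ 2

theorem map_quinVal {R S : Type*} [CommRing R] [CommRing S] (f : R →+* S) (a b γ₂ γ₃ : R)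
    (v : Fin 5 → R) :
    f (quinVal a b γ₂ γ₃ v) = quinVal (f a) (f b) (f γ₂) (f γ₃) (fun i => f (v i)) := by
  simp [quinVal]

theorem ternAniso_frobSqAdjoin {F : Type*} [Field F] [CharP F 2] {a b γ₂ γ₃ : F}
    (hN : ∀ x y : F, a * x ^ 2 + x * y + b * y ^ 2 ∈ sqAdjoin γ₂ γ₃ → x = 0 ∧ y = 0) :
    TernAniso (frobSqAdjoin γ₂ γ₃ a) (frobSqAdjoin γ₂ γ₃ b) := by
  have h2 : (2 : F) = 0 := CharTwo.two_eq_zero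
  rintro ⟨X, hX⟩ ⟨Y, hY⟩ ⟨Z, hZ⟩ h
  have h' : a ^ 2 * X ^ 2 + X * Y + b ^ 2 * Y ^ 2 + Z ^ 2 = 0 := congrArg Subtype.val h
  have hsq : X * Y = (a * X + b * Y + Z) ^ 2 := by
    linear_combination h' - (a ^ 2 * X ^ 2 + b ^ 2 * Y ^ 2 + Z ^ 2 + a * X * b * Y + a * X * Z
      + b * Y * Z) * h2
  have hX0 : X = 0 := by
    by_contra hX0
    set m := (a * X + b * Y + Z) / X with hm
    have hYm : Y / X = m ^ 2 := by
      rw [hm, div_pow, ← hsq]; field_simp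
    have := hN 1 m (by
      have : a * 1 ^ 2 + 1 * m + b * m ^ 2 = Z / X := by
        rw [← hYm, hm]; field_simp
        linear_combination (a * X + b * Y) * h2
      rw [this]
      exact div_mem hZ hX)
    exact one_ne_zero this.1
  have hY0 : Y = 0 := by
    by_contra hY0
    subst hX0
    have := hN 0 1 (by
      have : a * 0 ^ 2 + 0 * 1 + b * 1 ^ 2 = Z / Y := by
        field_simp
        have : (b * Y + Z) ^ 2 = 0 := by linear_combination -hsq
        linear_combination (pow_eq_zero_iff two_ne_zero).1 this - Z * h2
      rw [this]
      exact div_mem hZ hY)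
    exact one_ne_zero this.2
  subst hX0 hY0
  have hZ0 : Z = 0 := (pow_eq_zero_iff two_ne_zero).1 (by linear_combination h')
  subst hZ0
  exact ⟨rfl, rfl, rfl⟩

theorem no_ternVal_generic_add {L σ : Type*} [Field L] [Infinite L] [CharP L 2] {a b A : L}
    (hab : TernAniso a b) (hA : ¬ IsSquare A) (k B : L) (c : MvPolynomial σ L) (i : σ)
    (hc : pderiv i c ≠ 0) (h U₁ U₂ U₃ : MvPolynomial (Option (Option σ)) L) (hh : h ≠ 0)
    (hU : ternVal (C a) (C b) U₁ U₂ U₃ = h ^ 2 * (C A * X (some none) ^ 2 +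
      C k * X (some none) * X none + C B * X none ^ 2 + rename (some ∘ some) c)) : False := by
  obtain ⟨E, hE⟩ : ∃ E, E = optionEquivLeft L (Option σ) := ⟨_, rfl⟩
  obtain ⟨E', hE'⟩ : ∃ E', E' = optionEquivLeft L σ := ⟨_, rfl⟩
  have hr : ∀ q : MvPolynomial σ L, E' (Polynomial.eval 0 (E (rename (some ∘ some) q))) =
      Polynomial.C q := fun q => by
    induction q using MvPolynomial.induction_on with
    | C x => simp [hE, hE']
    | add p q hp hq => simp only [map_add, Polynomial.eval_add, hp, hq]
    | mul_X p j hp =>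
      simp only [map_mul, Polynomial.eval_mul, hp]
      simp [hE, hE']
  have hδ : E' (Polynomial.eval 0 (E (C A * X (some none) ^ 2 + C k * X (some none) * X none +
      C B * X none ^ 2 + rename (some ∘ some) c))) =
      Polynomial.C (C A) * Polynomial.X ^ 2 + Polynomial.C c := by
    simp only [map_add, Polynomial.eval_add, hr]
    simp [hE, hE']
  have hU₁ := congrArg E hU
  rw [map_ternVal, map_mul, map_pow] at hU₁
  have hEC : ∀ x : L, E (C x) = Polynomial.C (C x) := fun x => by simp [hE]
  have hEC' : ∀ x : L, E' (C x) = Polynomial.C (C x) := fun x => by simp [hE']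
  rw [hEC, hEC] at hU₁
  obtain ⟨h', V₁, V₂, V₃, hh', hV⟩ := exists_ternVal_constant_coeff
    (hab.mvPolynomial (σ := Option σ)) _ (E h) ((map_ne_zero_iff E E.injective).2 hh)
    (E U₁) (E U₂) (E U₃) hU₁
  have hV₁ := congrArg E' hV
  rw [map_ternVal, map_mul, map_pow, hEC', hEC', hδ] at hV₁
  exact no_ternVal_generic hab hA c i hc (E' h') (E' V₁) (E' V₂)
    (E' V₃) ((map_ne_zero_iff E' E'.injective).2 hh') hV₁

/-- Over a purely transcendental extension, a form `[a, b] ⊥ ⟨1, γ₂, γ₃⟩` whose binary part does not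
represent elements of `F²(γ₂, γ₃)` stays anisotropic after adjoining the square root of the
generic value `δ` of `[A, B] ⊥ c`. -/
theorem no_quinVal_generic {F σ : Type*} [Field F] [CharP F 2] [Infinite F] {a b γ₂ γ₃ : F}
    (hγ : ∀ p q r : F, p ^ 2 + γ₂ * q ^ 2 + γ₃ * r ^ 2 = 0 → p = 0 ∧ q = 0 ∧ r = 0)
    (hN : ∀ x y : F, a * x ^ 2 + x * y + b * y ^ 2 ∈ sqAdjoin γ₂ γ₃ → x = 0 ∧ y = 0)
    {A : F} (hA : A ∉ sqAdjoin γ₂ γ₃) (k B : F) (c : MvPolynomial σ F) (i : σ)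
    (hc : pderiv i c ≠ 0) (r₀ r₁ : Fin 5 → MvPolynomial (Option (Option σ)) F)
    (hne : ¬ (r₀ = 0 ∧ r₁ = 0))
    (hval : quinVal (C a) (C b) (C γ₂) (C γ₃) r₀ =
      (C A * X (some none) ^ 2 + C k * X (some none) * X none + C B * X none ^ 2 +
        rename (some ∘ some) c) * quinVal (C a) (C b) (C γ₂) (C γ₃) r₁)
    (hpol : r₀ 0 * r₁ 1 = r₁ 0 * r₀ 1) : False := by
  set f := frobSqAdjoin γ₂ γ₃ with hf
  have hfi : Function.Injective f := f.injective
  have : Infinite (sqAdjoin γ₂ γ₃) := Infinite.of_injective f hfi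
  have : CharP (sqAdjoin γ₂ γ₃) 2 := charP_of_injective_ringHom hfi 2
  have hab := ternAniso_frobSqAdjoin hN
  rw [← hf] at hab
  let g₂ : sqAdjoin γ₂ γ₃ := ⟨γ₂, left_mem_sqAdjoin _ _⟩
  let g₃ : sqAdjoin γ₂ γ₃ := ⟨γ₃, right_mem_sqAdjoin _ _⟩
  have hg₂ : f γ₂ = g₂ ^ 2 := rfl
  have hg₃ : f γ₃ = g₃ ^ 2 := rfl
  let M := MvPolynomial.map (σ := Option (Option σ)) f
  let W : (Fin 5 → MvPolynomial (Option (Option σ)) F) →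
      MvPolynomial (Option (Option σ)) (sqAdjoin γ₂ γ₃) :=
    fun r => M (r 2) + C g₂ * M (r 3) + C g₃ * M (r 4)
  have hM : ∀ r, M (quinVal (C a) (C b) (C γ₂) (C γ₃) r) =
      ternVal (C (f a)) (C (f b)) (M (r 0)) (M (r 1)) (W r) := fun r => by
    rw [map_quinVal]
    simp only [M, W, map_C, hg₂, hg₃, quinVal, ternVal, CharTwo.add_sq, map_pow]
    ring
  have hMi : Function.Injective M := MvPolynomial.map_injective f hfi
  have hzero : ∀ r, M (r 0) = 0 → M (r 1) = 0 → W r = 0 → r = 0 := by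
    intro r h0 h1 hW
    have hcoef : ∀ m, coeff m (r 2) = 0 ∧ coeff m (r 3) = 0 ∧ coeff m (r 4) = 0 := by
      intro m
      refine hγ _ _ _ ?_
      have := congrArg (coeff m) hW
      simp only [W, M, coeff_add, coeff_C_mul, coeff_map, coeff_zero] at this
      exact congrArg Subtype.val this
    funext j
    fin_cases j
    · exact hMi (by simpa using h0)
    · exact hMi (by simpa using h1)
    · exact MvPolynomial.ext _ _ fun m => (hcoef m).1
    · exact MvPolynomial.ext _ _ fun m => (hcoef m).2.1
    · exact MvPolynomial.ext _ _ fun m => (hcoef m).2.2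
  obtain ⟨h, U₁, U₂, U₃, hh, hU⟩ := exists_ternVal_of_orthogonal_pair
    (hab.mvPolynomial (σ := Option (Option σ)))
    (M (C A * X (some none) ^ 2 + C k * X (some none) * X none + C B * X none ^ 2 +
        rename (some ∘ some) c)) (M (r₀ 0)) (M (r₀ 1)) (W r₀) (M (r₁ 0)) (M (r₁ 1)) (W r₁)
    (fun ⟨h₁, h₂, h₃, h₄, h₅, h₆⟩ => hne ⟨hzero _ h₁ h₂ h₃, hzero _ h₄ h₅ h₆⟩)
    (by rw [← hM, hval, map_mul, hM]) (by rw [← map_mul, hpol, map_mul])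
  have hδ : M (C A * X (some none) ^ 2 + C k * X (some none) * X none + C B * X none ^ 2 +
      rename (some ∘ some) c) = C (f A) * X (some none) ^ 2 + C (f k) * X (some none) * X none +
        C (f B) * X none ^ 2 + rename (some ∘ some) (MvPolynomial.map f c) := by
    simp only [M, map_add, map_mul, map_pow, map_C, map_X, map_rename]
  rw [hδ] at hU
  refine no_ternVal_generic_add hab (A := f A) ?_ (f k) (f B) (MvPolynomial.map f c) i ?_ h U₁ U₂ U₃
    hh hU
  · rintro ⟨n, hn⟩
    have hn' : A ^ 2 = (n : F) * n := congrArg Subtype.val hn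
    have : (A + n) ^ 2 = 0 := by rw [CharTwo.add_sq, hn', ← pow_two, CharTwo.add_self_eq_zero]
    have hAn : A = n := CharTwo.add_eq_zero.1 ((pow_eq_zero_iff two_ne_zero).1 this)
    exact hA (hAn ▸ n.2)
  · rw [pderiv_map]
    exact (map_ne_zero_iff _ (MvPolynomial.map_injective f hfi)).2 hc

theorem toQuadraticForm_eq_sum {K ι : Type*} [CommRing K] [Fintype ι] [DecidableEq ι]
    (M : Matrix ι ι K) (v : ι → K) :
    M.toQuadraticForm' v = ∑ i, ∑ j, M i j * (v i * v j) := by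
  rw [Matrix.toQuadraticForm', LinearMap.BilinMap.toQuadraticMap_apply,
    Matrix.toLinearMap₂'_apply]
  exact Finset.sum_congr rfl fun i _ => Finset.sum_congr rfl fun j _ => by
    simp only [smul_eq_mul]; ring

theorem binQF_apply {K : Type} [CommRing K] (a b : K) (v : Fin 2 → K) :
    binQF a b v = a * v 0 ^ 2 + v 0 * v 1 + b * v 1 ^ 2 := by
  refine (toQuadraticForm_eq_sum _ v).trans ?_
  simp [Fin.sum_univ_two]
  ring

theorem diagQF_apply {K : Type} [CommRing K] {s : ℕ} (c v : Fin s → K) :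
    diagQF c v = ∑ i, c i * v i ^ 2 := by
  simp [diagQF, QuadraticMap.weightedSumSquares_apply, pow_two]

theorem binsQF_apply {K : Type} [CommRing K] {r : ℕ} (a b : Fin r → K) (v : Fin r → Fin 2 → K) :
    binsQF a b v = ∑ i, (a i * v i 0 ^ 2 + v i 0 * v i 1 + b i * v i 1 ^ 2) := by
  simp [binsQF, QuadraticMap.pi_apply, binQF_apply]

theorem pfisterQF_two_apply {K : Type} [CommRing K] (a : Fin 2 → K) (c : K)
    (v : Finset (Fin 2) → Fin 2 → K) :
    pfisterQF 2 a c v = binQF 1 c (v ∅) + a 0 * binQF 1 c (v {0}) + a 1 * binQF 1 c (v {1}) +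
      a 0 * a 1 * binQF 1 c (v {0, 1}) := by
  have : (Finset.univ : Finset (Finset (Fin 2))) = {∅, {0}, {1}, {0, 1}} := by decide
  rw [pfisterQF, QuadraticMap.pi_apply, this, Finset.sum_insert (by decide),
    Finset.sum_insert (by decide), Finset.sum_insert (by decide), Finset.sum_singleton]
  simp [add_assoc]

theorem isPfisterNeighbour_of_mem_sqAdjoin {F V : Type} [Field F] [CharP F 2] [AddCommGroup V]
    [Module F V] {φ : QuadraticForm F V} (hφ : φ.Anisotropic) (g : V ≃ₗ[F] (Fin 5 → F))
    {κ a b γ₂ γ₃ : F} (hκ : κ ≠ 0) (hg : ∀ v, φ v = κ * quinVal a b γ₂ γ₃ (g v)) {m n : F}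
    (hmn : ¬ (m = 0 ∧ n = 0)) (hmem : a * m ^ 2 + m * n + b * n ^ 2 ∈ sqAdjoin γ₂ γ₃) :
    IsPfisterNeighbour φ := by
  have h2 : (2 : F) = 0 := CharTwo.two_eq_zero
  have hq : ∀ v, quinVal a b γ₂ γ₃ v = 0 → v = 0 := fun v hv => by
    have := hφ (g.symm v) (by rw [hg, g.apply_symm_apply, hv, mul_zero])
    simpa using this
  have hγ₂ : γ₂ ≠ 0 := by
    rintro rfl
    simpa using congrFun (hq ![0, 0, 0, 1, 0] (by simp [quinVal])) 3
  have hγ₃ : γ₃ ≠ 0 := by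
    rintro rfl
    simpa using congrFun (hq ![0, 0, 0, 0, 1] (by simp [quinVal])) 4
  obtain ⟨p, q, r, s, hs⟩ := hmem
  have hs0 : s ≠ 0 := by
    rintro rfl
    have := hq ![m, n, p, q, r] (by
      simp only [quinVal]
      simp
      linear_combination hs + (p ^ 2 + γ₂ * q ^ 2 + γ₃ * r ^ 2) * h2)
    exact hmn ⟨congrFun this 0, congrFun this 1⟩
  obtain ⟨m', n', hdet⟩ : ∃ m' n' : F, m * n' + n * m' = 1 := by
    by_cases hm : m = 0
    · have hn : n ≠ 0 := fun hn => hmn ⟨hm, hn⟩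
      exact ⟨1 / n, 0, by field_simp; ring⟩
    · exact ⟨0, 1 / m, by field_simp; ring⟩
  set e := a * m' ^ 2 + m' * n' + b * n' ^ 2 with he
  let x : Fin 5 → V →ₗ[F] F := fun i => LinearMap.proj i ∘ₗ g.toLinearMap
  let α : V →ₗ[F] F := n' • x 0 + m' • x 1
  let β : V →ₗ[F] F := n • x 0 + m • x 1
  let fS : Finset (Fin 2) → V →ₗ[F] (Fin 2 → F) := fun S =>
    if S = ∅ then LinearMap.pi ![x 2 + p • α, 0]
    else if S = {0} then LinearMap.pi ![x 3 + q • α, 0]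
    else if S = {1} then LinearMap.pi ![x 4 + r • α, 0]
    else LinearMap.pi ![s • α, (γ₂ * γ₃ * s)⁻¹ • β]
  have hval : ∀ v, κ⁻¹ * φ v =
      pfisterQF 2 ![γ₂, γ₃] (e * γ₂ * γ₃ * s ^ 2) (LinearMap.pi fS v) := by
    intro v
    have f1 : fS ∅ = LinearMap.pi ![x 2 + p • α, 0] := if_pos rfl
    have f2 : fS {0} = LinearMap.pi ![x 3 + q • α, 0] := by
      simp [fS]
    have f3 : fS {1} = LinearMap.pi ![x 4 + r • α, 0] := by
      simp [fS]
    have f4 : fS {0, 1} = LinearMap.pi ![s • α, (γ₂ * γ₃ * s)⁻¹ • β] := by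
      simp only [fS]; rw [if_neg (by decide), if_neg (by decide), if_neg (by decide)]
    rw [pfisterQF_two_apply, hg, inv_mul_cancel_left₀ hκ]
    simp only [LinearMap.pi_apply, f1, f2, f3, f4, binQF_apply]
    obtain ⟨y, hy⟩ : ∃ y, y = g v := ⟨_, rfl⟩
    simp only [quinVal, Matrix.cons_val_zero, Matrix.cons_val_one, LinearMap.add_apply,
      LinearMap.smul_apply, LinearMap.zero_apply, α, β, x, LinearMap.comp_apply,
      LinearMap.proj_apply, LinearEquiv.coe_coe, ← hy, smul_eq_mul]
    have hy0 : y 0 = (n' * y 0 + m' * y 1) * m + (n * y 0 + m * y 1) * m' := by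
      linear_combination (-y 0) * hdet - y 1 * m * m' * h2
    have hy1 : y 1 = (n' * y 0 + m' * y 1) * n + (n * y 0 + m * y 1) * n' := by
      linear_combination (-y 1) * hdet - y 0 * n * n' * h2
    set A := n' * y 0 + m' * y 1
    set B := n * y 0 + m * y 1
    rw [hy0, hy1]
    have hcalc : γ₂ * γ₃ * (1 * (s * A) ^ 2 + s * A * ((γ₂ * γ₃ * s)⁻¹ * B) +
        e * γ₂ * γ₃ * s ^ 2 * ((γ₂ * γ₃ * s)⁻¹ * B) ^ 2) =
        γ₂ * γ₃ * s ^ 2 * A ^ 2 + A * B + e * B ^ 2 := by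
      field_simp
    rw [hcalc, he]
    linear_combination A ^ 2 * hs + A * B * hdet + (a * m * m' * A * B + b * n * n' * A * B
      - p * A * y 2 - γ₂ * q * A * y 3 - γ₃ * r * A * y 4) * h2
  refine ⟨2, ![Units.mk0 γ₂ hγ₂, Units.mk0 γ₃ hγ₃], e * γ₂ * γ₃ * s ^ 2, ?_,
    Units.mk0 κ⁻¹ (inv_ne_zero hκ), LinearMap.pi fS, ?_, ?_⟩
  · rw [g.finrank_eq]; simp
  · rw [← LinearMap.ker_eq_bot, LinearMap.ker_eq_bot']
    intro v hv
    have := hval v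
    rw [hv, QuadraticMap.map_zero, mul_eq_zero] at this
    exact hφ v (this.resolve_left (inv_ne_zero hκ))
  · intro v
    have : (fun i => ((![Units.mk0 γ₂ hγ₂, Units.mk0 γ₃ hγ₃] : Fin 2 → Fˣ) i : F)) =
        ![γ₂, γ₃] := by
      funext i; fin_cases i <;> rfl
    rw [this, ← hval]
    rfl

theorem eval_qfPoly {F : Type} [Field F] {n : ℕ} (ψ : QuadraticForm F (Fin n → F))
    (x : Fin n → F) : eval x (qfPoly F ψ) = ψ x := by
  have h : ψ.toBilin (Pi.basisFun F (Fin n)) = Matrix.toLinearMap₂' F (coeffMat F ψ) := by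
    refine (Pi.basisFun F (Fin n)).ext fun i => (Pi.basisFun F (Fin n)).ext fun j => ?_
    rw [toBilin_apply, Pi.basisFun_apply, Pi.basisFun_apply]
    simp [Matrix.toLinearMap₂'_apply, Pi.single_apply]
    rfl
  conv_rhs => rw [← toQuadraticMap_toBilin ψ (Pi.basisFun F (Fin n)), h]
  refine Eq.trans ?_ (toQuadraticForm_eq_sum _ x).symm
  simp [qfPoly]

theorem extendQF_apply {F : Type} [Field F] {K : Type} [CommRing K] (f : F →+* K) {n : ℕ}
    (φ : QuadraticForm F (Fin n → F)) (v : Fin n → K) :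
    extendQF F f φ v = eval₂ f v (qfPoly F φ) := by
  refine (toQuadraticForm_eq_sum _ v).trans ?_
  simp [qfPoly, eval₂_sum]

/-- Coordinate functions of a linear map, as linear polynomials. -/
noncomputable def linPoly {F ι κ : Type*} [Field F] [Fintype ι] [DecidableEq ι]
    (G : (ι → F) →ₗ[F] (κ → F)) (j : κ) : MvPolynomial ι F :=
  ∑ i, C (G (Pi.single i 1) j) * X i

theorem eval_linPoly {F ι κ : Type*} [Field F] [Fintype ι] [DecidableEq ι]
    (G : (ι → F) →ₗ[F] (κ → F)) (j : κ) (x : ι → F) : eval x (linPoly G j) = G x j := by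
  conv_rhs => rw [← Finset.univ_sum_single x]
  simp only [map_sum, Finset.sum_apply, linPoly, map_mul, eval_C, eval_X]
  refine Finset.sum_congr rfl fun i _ => ?_
  have : (Pi.single i (x i) : ι → F) = x i • Pi.single i 1 := by simp [← Pi.single_smul]
  rw [this, map_smul, Pi.smul_apply, smul_eq_mul, mul_comm]

theorem exists_pair_of_dvd {R : Type*} [CommRing R] [IsDomain R] [CharP R 2] {a b γ₂ γ₃ δ : R}
    {q : Fin 5 → Polynomial R}
    (hq : Polynomial.X ^ 2 + Polynomial.C δ ∣ quinVal (Polynomial.C a) (Polynomial.C b)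
      (Polynomial.C γ₂) (Polynomial.C γ₃) q)
    (hne : ∃ j, ¬ Polynomial.X ^ 2 + Polynomial.C δ ∣ q j) :
    ∃ r₀ r₁ : Fin 5 → R, ¬ (r₀ = 0 ∧ r₁ = 0) ∧
      quinVal a b γ₂ γ₃ r₀ = δ * quinVal a b γ₂ γ₃ r₁ ∧ r₀ 0 * r₁ 1 = r₁ 0 * r₀ 1 := by
  have h2 : (2 : R) = 0 := CharTwo.two_eq_zero
  set D : Polynomial R := Polynomial.X ^ 2 + Polynomial.C δ with hD
  have hm : D.Monic := Polynomial.monic_X_pow_add_C δ two_ne_zero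
  have hdeg : D.degree = 2 := Polynomial.degree_X_pow_add_C two_pos δ
  set r₁ : Fin 5 → R := fun j => (q j %ₘ D).coeff 1
  set r₀ : Fin 5 → R := fun j => (q j %ₘ D).coeff 0
  have hr : ∀ j, q j %ₘ D = Polynomial.C (r₁ j) * Polynomial.X + Polynomial.C (r₀ j) :=
    fun j => Polynomial.eq_X_add_C_of_degree_le_one <| by
      have := Polynomial.degree_modByMonic_lt (q j) hm
      rw [hdeg] at this
      exact Order.le_of_lt_succ this
  have hdvd : D ∣ quinVal (Polynomial.C a) (Polynomial.C b) (Polynomial.C γ₂)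
      (Polynomial.C γ₃) (fun j => q j %ₘ D) := by
    rw [← Ideal.mem_span_singleton, ← Ideal.Quotient.eq_zero_iff_mem] at hq ⊢
    rw [map_quinVal] at hq ⊢
    rw [← hq]
    congr 1
    funext j
    rw [Ideal.Quotient.eq, Ideal.mem_span_singleton]
    exact ⟨-(q j /ₘ D), by linear_combination Polynomial.modByMonic_add_div (q j) D⟩
  have h2' : (2 : Polynomial R) = 0 := CharTwo.two_eq_zero
  set cr := r₀ 0 * r₁ 1 - r₁ 0 * r₀ 1
  set e := quinVal a b γ₂ γ₃ r₀ - δ * quinVal a b γ₂ γ₃ r₁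
  have hsplit : quinVal (Polynomial.C a) (Polynomial.C b) (Polynomial.C γ₂)
      (Polynomial.C γ₃) (fun j => q j %ₘ D) = D * Polynomial.C (quinVal a b γ₂ γ₃ r₁) +
        (Polynomial.C cr * Polynomial.X + Polynomial.C e) := by
    have key : ∀ u v X : Polynomial R, (u * X + v) ^ 2 = u ^ 2 * X ^ 2 + v ^ 2 := fun u v X => by
      linear_combination u * v * X * h2'
    simp only [hr]
    simp only [quinVal, key, cr, e, map_sub, map_add, map_mul, map_pow, hD]
    linear_combination Polynomial.C (r₁ 0) * Polynomial.C (r₀ 1) * Polynomial.X * h2'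
  have hlin : Polynomial.C cr * Polynomial.X + Polynomial.C e = 0 := by
    refine Polynomial.eq_zero_of_dvd_of_degree_lt (p := D) ?_ ?_
    · rw [hsplit] at hdvd
      exact (dvd_add_right (Dvd.intro _ rfl)).mp hdvd
    · rw [hdeg]
      exact lt_of_le_of_lt Polynomial.degree_linear_le (by norm_num)
  refine ⟨r₀, r₁, ?_, ?_, ?_⟩
  · rintro ⟨h0, h1⟩
    obtain ⟨j, hj⟩ := hne
    apply hj
    rw [← Polynomial.modByMonic_eq_zero_iff_dvd hm, hr, h0, h1]
    simp
  · have := congrArg (Polynomial.coeff · 0) hlin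
    simpa [e, sub_eq_zero] using this
  · have := congrArg (Polynomial.coeff · 1) hlin
    simpa [cr, sub_eq_zero] using this

/-- The quotient map onto the affine coordinate ring of the quadric. -/
noncomputable def mkFunFieldRing {F : Type} [Field F] {n : ℕ} (ψ : QuadraticForm F (Fin n → F)) :
    MvPolynomial (Fin n) F →+* FunFieldRing F ψ :=
  Ideal.Quotient.mk _

theorem mkFunFieldRing_surjective {F : Type} [Field F] {n : ℕ} (ψ : QuadraticForm F (Fin n → F)) :
    Function.Surjective (mkFunFieldRing ψ) :=
  Ideal.Quotient.mk_surjective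

theorem mkFunFieldRing_eq_zero_iff {F : Type} [Field F] {n : ℕ}
    (ψ : QuadraticForm F (Fin n → F)) (p : MvPolynomial (Fin n) F) :
    mkFunFieldRing ψ p = 0 ↔ qfPoly F ψ ∣ p :=
  Ideal.Quotient.eq_zero_iff_mem.trans Ideal.mem_span_singleton

instance {F : Type} [Field F] {n : ℕ} (ψ : QuadraticForm F (Fin n → F)) :
    IsLocalization (nonZeroDivisors (FunFieldRing F ψ)) (FunField F ψ) :=
  inferInstanceAs (IsLocalization (nonZeroDivisors (FunFieldRing F ψ))
    (FractionRing (FunFieldRing F ψ)))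

theorem exists_dvd_of_not_anisotropic {F : Type} [Field F] {m n : ℕ}
    (φ : QuadraticForm F (Fin m → F)) (ψ : QuadraticForm F (Fin n → F))
    (h : ¬ (extendQF F (funFieldMap F ψ) φ).Anisotropic) :
    ∃ p : Fin m → MvPolynomial (Fin n) F, qfPoly F ψ ∣ aeval p (qfPoly F φ) ∧
      ∃ i, ¬ qfPoly F ψ ∣ p i := by
  simp only [QuadraticMap.Anisotropic, not_forall] at h
  obtain ⟨v, hv, hv0⟩ := h
  obtain ⟨d, hd⟩ := IsLocalization.exist_integer_multiples_of_finite
    (nonZeroDivisors (FunFieldRing F ψ)) v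
  choose w hw using hd
  choose p hp using fun i => mkFunFieldRing_surjective ψ (w i)
  have hd : IsUnit (algebraMap (FunFieldRing F ψ) (FunField F ψ) d) :=
    IsLocalization.map_units _ d
  simp only [Algebra.smul_def] at hw
  refine ⟨p, ?_, ?_⟩
  · rw [← mkFunFieldRing_eq_zero_iff]
    apply IsLocalization.injective (FunField F ψ) (le_refl (nonZeroDivisors (FunFieldRing F ψ)))
    have hq := QuadraticMap.map_smul (extendQF F (funFieldMap F ψ) φ)
      (algebraMap (FunFieldRing F ψ) (FunField F ψ) d) v
    have hdv : algebraMap (FunFieldRing F ψ) (FunField F ψ) d • v =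
        fun i => algebraMap (FunFieldRing F ψ) (FunField F ψ) (w i) :=
      funext fun i => (hw i).symm
    rw [hv, smul_zero, extendQF_apply, hdv] at hq
    rw [map_zero, ← hq, aeval_def, ← RingHom.comp_apply, hom_eval₂]
    simp only [RingHom.comp_apply, hp]
    congr 1
  · by_contra! hall
    refine hv0 (funext fun i => hd.mul_right_eq_zero.mp ?_)
    rw [← hw, ← hp, (mkFunFieldRing_eq_zero_iff ψ _).mpr (hall i), map_zero]

theorem eval_aeval_linPoly {F ι κ : Type*} [Field F] [Fintype ι] [DecidableEq ι]
    (G : (ι → F) →ₗ[F] (κ → F)) (x : ι → F) (P : MvPolynomial κ F) :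
    eval x (aeval (linPoly G) P) = eval (G x) P := by
  rw [aeval_def, hom_eval₂, eval,
    coe_eval₂Hom]
  congr 1
  · ext c
    simp
  · exact funext fun j => eval_linPoly G j x

theorem exists_pair_of_not_anisotropic {F τ : Type} [Field F] [CharP F 2] [Infinite F] {n : ℕ}
    [Fintype τ] [DecidableEq τ]
    {φ : QuadraticForm F (Fin 5 → F)} {ψ : QuadraticForm F (Fin n → F)}
    (h : ¬ (extendQF F (funFieldMap F ψ) φ).Anisotropic)
    (g : (Fin 5 → F) ≃ₗ[F] (Fin 5 → F)) {κ a b γ₂ γ₃ : F} (hκ : κ ≠ 0)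
    (hg : ∀ v, φ v = κ * quinVal a b γ₂ γ₃ (g v))
    (G : (Fin n → F) ≃ₗ[F] (Option τ → F)) {κ' : F} (hκ' : κ' ≠ 0) (δ : MvPolynomial τ F)
    (hG : ∀ v, ψ v = κ' * (G v none ^ 2 + eval (fun j => G v (some j)) δ)) :
    ∃ r₀ r₁ : Fin 5 → MvPolynomial τ F, ¬ (r₀ = 0 ∧ r₁ = 0) ∧
      quinVal (C a) (C b) (C γ₂) (C γ₃) r₀ = δ * quinVal (C a) (C b) (C γ₂) (C γ₃) r₁ ∧
      r₀ 0 * r₁ 1 = r₁ 0 * r₀ 1 := by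
  obtain ⟨p, hp, hpn⟩ := exists_dvd_of_not_anisotropic φ ψ h
  let Θ : MvPolynomial (Fin n) F →ₐ[F] MvPolynomial (Option τ) F :=
    aeval (linPoly G.symm.toLinearMap)
  let Θ' : MvPolynomial (Option τ) F →ₐ[F] MvPolynomial (Fin n) F := aeval (linPoly G.toLinearMap)
  have hΘΘ : ∀ P, Θ' (Θ P) = P := fun P => MvPolynomial.funext fun x => by
    rw [eval_aeval_linPoly, eval_aeval_linPoly, LinearEquiv.coe_coe, LinearEquiv.coe_coe,
      G.symm_apply_apply]
  set D : MvPolynomial (Option τ) F := X none ^ 2 + rename some δ with hD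
  have hψ : Θ (qfPoly F ψ) = C κ' * D := MvPolynomial.funext fun x => by
    rw [eval_aeval_linPoly, eval_qfPoly, LinearEquiv.coe_coe, hG, G.apply_symm_apply]
    simp [hD, eval_rename, Function.comp_def]
  have hu : IsUnit (C κ' : MvPolynomial (Option τ) F) := (IsUnit.mk0 κ' hκ').map C
  let P : Fin 5 → MvPolynomial (Fin n) F := fun j => aeval p (linPoly g.toLinearMap j)
  have hφ : aeval p (qfPoly F φ) = C κ * quinVal (C a) (C b) (C γ₂) (C γ₃) P := by
    have : qfPoly F φ = C κ * quinVal (C a) (C b) (C γ₂) (C γ₃) (linPoly g.toLinearMap) :=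
      MvPolynomial.funext fun x => by
        rw [eval_qfPoly, hg, map_mul, map_quinVal]
        simp [eval_linPoly]
    rw [this, map_mul, ← AlgHom.coe_toRingHom, map_quinVal]
    simp [P, algebraMap_eq]
  have hE : optionEquivLeft F τ D = Polynomial.X ^ 2 + Polynomial.C δ := by
    have h1 : ∀ P : MvPolynomial τ F,
        optionEquivLeft F τ (rename some P) = Polynomial.C P := fun P => by
      induction P using MvPolynomial.induction_on with
      | C c => simp
      | add p q hp hq => rw [map_add, map_add, hp, hq, Polynomial.C_add]
      | mul_X p i hp => simp [hp]
    rw [hD, map_add, map_pow, h1, optionEquivLeft_X_none]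
  obtain ⟨r₀, r₁, h1, h2, h3⟩ := exists_pair_of_dvd (a := (C a : MvPolynomial τ F)) (b := C b)
    (γ₂ := C γ₂) (γ₃ := C γ₃) (δ := δ) (q := fun j => optionEquivLeft F τ (Θ (P j))) (by
      have h1 : D ∣ Θ (quinVal (C a) (C b) (C γ₂) (C γ₃) P) := by
        rw [hφ] at hp
        have := map_dvd Θ (((IsUnit.mk0 κ hκ).map C).dvd_mul_left.mp hp)
        rw [hψ] at this
        exact (dvd_mul_left _ _).trans this
      have h2 := map_dvd (optionEquivLeft F τ) h1
      have h4 := map_quinVal ((optionEquivLeft F τ : _ →+* Polynomial (MvPolynomial τ F)).comp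
        (Θ : _ →+* MvPolynomial (Option τ) F))
        (C a) (C b) (C γ₂) (C γ₃) P
      have h5 : ∀ c : F, Θ (C c) = C c := fun c => by simp [Θ]
      simp only [RingHom.comp_apply, RingHom.coe_coe, h5, optionEquivLeft_C] at h4
      rwa [hE, h4] at h2) (by
      by_contra! hall
      obtain ⟨i, hi⟩ := hpn
      have hall' : ∀ j, qfPoly F ψ ∣ P j := fun j => by
        have := hall j
        rw [← hE, map_dvd_iff (optionEquivLeft F τ)] at this
        have h4 := map_dvd Θ' (hu.mul_left_dvd.mpr this)
        rwa [← hψ, hΘΘ, hΘΘ] at h4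
      have : p i = aeval P (linPoly g.symm.toLinearMap i) := by
        have h5 : aeval (linPoly g.toLinearMap) (linPoly g.symm.toLinearMap i) = X i :=
          MvPolynomial.funext fun x => by
            rw [eval_aeval_linPoly, eval_linPoly, eval_X, LinearEquiv.coe_coe,
              LinearEquiv.coe_coe, g.symm_apply_apply]
        rw [← aeval_X (R := F) p i, ← h5]
        change ((aeval p).comp (aeval (linPoly g.toLinearMap))) _ = _
        rw [comp_aeval]
      apply hi
      rw [this, linPoly, map_sum]
      refine Finset.dvd_sum fun j _ => ?_
      rw [map_mul, aeval_X]
      exact Dvd.dvd.mul_left (hall' j) _)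
  exact ⟨r₀, r₁, h1, h2, h3⟩

theorem exists_quinVal_of_hasTypeRS {F V : Type} [Field F] [AddCommGroup V] [Module F V]
    {φ : QuadraticForm F V} (hφ : φ.Anisotropic) (ht : HasTypeRS φ 1 3) :
    ∃ (g : V ≃ₗ[F] (Fin 5 → F)) (κ a b γ₂ γ₃ : F), κ ≠ 0 ∧
      ∀ v, φ v = κ * quinVal a b γ₂ γ₃ (g v) := by
  obtain ⟨a, b, c, ⟨e⟩⟩ := ht
  have he : ∀ v, φ v = a 0 * (e v).1 0 0 ^ 2 + (e v).1 0 0 * (e v).1 0 1 +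
      b 0 * (e v).1 0 1 ^ 2 + (c 0 * (e v).2 0 ^ 2 + c 1 * (e v).2 1 ^ 2 +
        c 2 * (e v).2 2 ^ 2) := fun v => by
    rw [← e.map_app v, QuadraticMap.prod_apply, binsQF_apply, diagQF_apply, Fin.sum_univ_one,
      Fin.sum_univ_three]
  have hc : c 0 ≠ 0 := fun hc => by
    have h0 := hφ (e.symm (0, ![1, 0, 0])) (by
      rw [he, e.apply_symm_apply]
      simp [hc])
    have h1 : e (e.symm (0, ![1, 0, 0])) = 0 := by rw [h0]; exact map_zero e.toLinearEquiv
    rw [e.apply_symm_apply] at h1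
    simpa using congrFun (congrArg Prod.snd h1) 0
  let L : ((Fin 1 → Fin 2 → F) × (Fin 3 → F)) ≃ₗ[F] (Fin 5 → F) :=
    { toFun := fun p => ![p.1 0 0, (c 0)⁻¹ * p.1 0 1, p.2 0, p.2 1, p.2 2]
      invFun := fun w => (fun _ => ![w 0, c 0 * w 1], ![w 2, w 3, w 4])
      map_add' := fun p q => by ext i; fin_cases i <;> simp [mul_add]
      map_smul' := fun r p => by ext i; fin_cases i <;> simp [mul_left_comm]
      left_inv := fun p => by
        refine Prod.ext (funext fun i => funext fun j => ?_) (funext fun i => ?_)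
        · obtain rfl := Subsingleton.elim i 0
          fin_cases j <;> simp [hc]
        · fin_cases i <;> simp
      right_inv := fun w => by ext i; fin_cases i <;> simp [hc] }
  refine ⟨e.toLinearEquiv.trans L, c 0, a 0 / c 0, b 0 * c 0, c 1 / c 0, c 2 / c 0, hc,
    fun v => ?_⟩
  rw [he, LinearEquiv.trans_apply]
  change _ = c 0 * quinVal _ _ _ _ (L (e v))
  simp only [L, LinearEquiv.coe_mk, LinearMap.coe_mk, AddHom.coe_mk, quinVal]
  simp
  field_simp
  ring

theorem exists_add_sq_notMem {F : Type*} [Field F] [CharP F 2] [Infinite F] (N : Subfield F)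
    (hsq : ∀ x : F, x ^ 2 ∈ N) (hN : N ≠ ⊤) (a b : F) {k : F} (hk : k ≠ 0) :
    ∃ l : F, k * (a * l ^ 2 + l + b) ∉ N := by
  by_contra! hall
  have hb : k * b ∈ N := by simpa using hall 0
  have hadd : ∀ l, k * (a * l ^ 2 + l) ∈ N := fun l => by
    have := N.sub_mem (hall l) hb
    convert this using 1
    ring
  obtain ⟨y, hy⟩ := (Set.toFinite ({0, 1} : Set F)).exists_notMem
  simp only [Set.mem_insert_iff, Set.mem_singleton_iff, not_or] at hy
  obtain ⟨hy0, hy1⟩ := hy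
  have h2 : (2 : F) = 0 := CharTwo.two_eq_zero
  have hne : y ^ 2 * (y ^ 2 - 1) ≠ 0 := by
    have : y ^ 2 * (y ^ 2 - 1) = (y * (y - 1)) ^ 2 := by
      linear_combination (y ^ 3 - y ^ 2) * h2
    rw [this]
    exact pow_ne_zero 2 (mul_ne_zero hy0 (sub_ne_zero.mpr hy1))
  have hkN : k ∈ N := by
    have h1 := hadd 1
    have h3 := N.sub_mem (hadd (y ^ 2)) (N.mul_mem (hsq (y ^ 2)) h1)
    have h4 : k * (a * (y ^ 2) ^ 2 + y ^ 2) - (y ^ 2) ^ 2 * (k * (a * 1 ^ 2 + 1)) =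
        -(k * (y ^ 2 * (y ^ 2 - 1))) := by ring
    rw [h4, neg_mem_iff] at h3
    have h5 : y ^ 2 * (y ^ 2 - 1) ∈ N := N.mul_mem (hsq y) (N.sub_mem (hsq y) N.one_mem)
    have := N.mul_mem h3 (N.inv_mem h5)
    rwa [mul_inv_cancel_right₀ hne] at this
  have hsum : ∀ l, a * l ^ 2 + l ∈ N := fun l => by
    have := N.mul_mem (N.inv_mem hkN) (hadd l)
    rwa [inv_mul_cancel_left₀ hk] at this
  have haN : a ∈ N := by
    have := N.sub_mem (hsum 1) N.one_mem
    simpa using this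
  refine hN (eq_top_iff.mpr fun l _ => ?_)
  have := N.sub_mem (hsum l) (N.mul_mem haN (hsq l))
  simpa using this

/-- Coordinates on the space of `[a₁, b₁] ⊥ [a₂, b₂] ⊥ ⟨c₀, …, c_t⟩`, sheared by `l` along the
first plane. -/
def shearEquiv {F : Type} [Field F] (t : ℕ) (l : F) :
    ((Fin 2 → Fin 2 → F) × (Fin (t + 1) → F)) ≃ₗ[F]
      (Option (Option (Option (Fin 2 ⊕ Fin t))) → F) where
  toFun p := fun i => i.elim (p.2 0) fun i => i.elim (p.1 0 0 - l * p.1 0 1) fun i =>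
    i.elim (p.1 0 1) (Sum.elim (p.1 1) fun j => p.2 j.succ)
  invFun w := (![![w (some none) + l * w (some (some none)), w (some (some none))],
    fun i => w (some (some (some (Sum.inl i))))],
    Fin.cons (w none) fun j => w (some (some (some (Sum.inr j)))))
  map_add' p q := by
    funext i
    rcases i with _ | _ | _ | _ | _ <;> simp
    ring
  map_smul' r p := by
    funext i
    rcases i with _ | _ | _ | _ | _ <;> simp
    ring
  left_inv p := by
    refine Prod.ext (funext fun i => funext fun j => ?_) (funext fun i => ?_)
    · fin_cases i <;> fin_cases j <;> simp
    · refine Fin.cases ?_ (fun j => ?_) i <;> simp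
  right_inv w := by
    funext i
    rcases i with _ | _ | _ | _ | _ <;> simp

theorem exists_shear_of_hasTypeRS {F V : Type} [Field F] [CharP F 2] [Infinite F]
    [AddCommGroup V] [Module F V]
    {ψ : QuadraticForm F V} (hψ : ψ.Anisotropic) {t : ℕ} (ht : HasTypeRS ψ 2 (t + 1))
    (N : Subfield F) (hsq : ∀ x : F, x ^ 2 ∈ N) (hN : N ≠ ⊤) :
    ∃ (G : V ≃ₗ[F] (Option (Option (Option (Fin 2 ⊕ Fin t))) → F)) (κ A k B : F)
      (c : MvPolynomial (Fin 2 ⊕ Fin t) F), κ ≠ 0 ∧ A ∉ N ∧ pderiv (Sum.inl 0) c ≠ 0 ∧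
      ∀ v, ψ v = κ * (G v none ^ 2 + eval (fun j => G v (some j))
        (C A * X (some none) ^ 2 + C k * X (some none) * X none + C B * X none ^ 2 +
          rename (some ∘ some) c)) := by
  obtain ⟨a, b, c, ⟨e⟩⟩ := ht
  have h2 : (2 : F) = 0 := CharTwo.two_eq_zero
  have he : ∀ v, ψ v = (a 0 * (e v).1 0 0 ^ 2 + (e v).1 0 0 * (e v).1 0 1 +
      b 0 * (e v).1 0 1 ^ 2) + (a 1 * (e v).1 1 0 ^ 2 + (e v).1 1 0 * (e v).1 1 1 +
      b 1 * (e v).1 1 1 ^ 2) + (c 0 * (e v).2 0 ^ 2 +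
        ∑ j : Fin t, c j.succ * (e v).2 j.succ ^ 2) := fun v => by
    rw [← e.map_app v, QuadraticMap.prod_apply, binsQF_apply, diagQF_apply, Fin.sum_univ_two,
      Fin.sum_univ_succ]
  have hc : c 0 ≠ 0 := fun hc => by
    have h0 := hψ (e.symm (0, Pi.single 0 1)) (by
      rw [he, e.apply_symm_apply]
      simp [hc])
    have h1 : e (e.symm (0, Pi.single 0 1)) = 0 := by rw [h0]; exact map_zero e.toLinearEquiv
    rw [e.apply_symm_apply] at h1
    simpa using congrFun (congrArg Prod.snd h1) 0
  have hk : (c 0)⁻¹ ≠ 0 := inv_ne_zero hc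
  obtain ⟨l, hl⟩ := exists_add_sq_notMem N hsq hN (a 0) (b 0) hk
  refine ⟨e.toLinearEquiv.trans (shearEquiv t l), c 0, _, (c 0)⁻¹, (c 0)⁻¹ * a 0,
    C ((c 0)⁻¹ * a 1) * X (Sum.inl 0) ^ 2 + C (c 0)⁻¹ * X (Sum.inl 0) * X (Sum.inl 1) +
      C ((c 0)⁻¹ * b 1) * X (Sum.inl 1) ^ 2 +
      ∑ j : Fin t, C ((c 0)⁻¹ * c j.succ) * X (Sum.inr j) ^ 2, hc, hl, ?_, fun v => ?_⟩
  · have h2' : (2 : MvPolynomial (Fin 2 ⊕ Fin t) F) = 0 := CharTwo.two_eq_zero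
    simp [pderiv_X, h2', hc]
  · rw [he, LinearEquiv.trans_apply]
    change _ = c 0 * (shearEquiv t l (e v) none ^ 2 +
      eval (fun j => shearEquiv t l (e v) (some j)) _)
    obtain ⟨w, hw⟩ : ∃ w, w = e v := ⟨_, rfl⟩
    rw [← hw]
    simp [shearEquiv, Function.comp_def, mul_add, Finset.mul_sum, mul_assoc, hc]
    field_simp
    linear_combination (a 0 * w.1 0 0 * w.1 0 1 * l - a 0 * w.1 0 1 ^ 2 * l ^ 2) * h2

theorem stmt3 (F : Type) [Field F] [CharP F 2]
    (φ : QuadraticForm F (Fin 5 → F)) (hφa : φ.Anisotropic) (hφt : HasTypeRS φ 1 3)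
    (hφpn : ¬ IsPfisterNeighbour φ)
    (s : ℕ) (hs : 1 ≤ s) (ψ : QuadraticForm F (Fin (4 + s) → F))
    (hψa : ψ.Anisotropic) (hψt : HasTypeRS ψ 2 s) :
    (extendQF F (funFieldMap F ψ) φ).Anisotropic := by
  by_contra h
  obtain ⟨t, rfl⟩ : ∃ t, s = t + 1 := ⟨s - 1, by omega⟩
  obtain ⟨g, κ, a, b, γ₂, γ₃, hκ, hg⟩ := exists_quinVal_of_hasTypeRS hφa hφt
  have hN : ∀ x y : F, a * x ^ 2 + x * y + b * y ^ 2 ∈ sqAdjoin γ₂ γ₃ → x = 0 ∧ y = 0 :=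
    fun x y hxy => by
      by_contra hne
      exact hφpn (isPfisterNeighbour_of_mem_sqAdjoin hφa g hκ hg hne hxy)
  have hq : ∀ v, quinVal a b γ₂ γ₃ v = 0 → v = 0 := fun v hv => by
    have := hφa (g.symm v) (by rw [hg, g.apply_symm_apply, hv, mul_zero])
    simpa using this
  have hγ : ∀ p q r : F, p ^ 2 + γ₂ * q ^ 2 + γ₃ * r ^ 2 = 0 → p = 0 ∧ q = 0 ∧ r = 0 :=
    fun p q r hpqr => by
      have := hq ![0, 0, p, q, r] (by simpa [quinVal] using hpqr)
      exact ⟨congrFun this 2, congrFun this 3, congrFun this 4⟩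
  have : Infinite F := by
    by_contra hfin
    rw [not_infinite_iff_finite] at hfin
    obtain ⟨x, hx⟩ := (Finite.injective_iff_surjective.mp (frobenius_inj F 2)) γ₂
    have := hγ x 1 0 (by
      rw [frobenius_def] at hx
      rw [hx]
      linear_combination γ₂ * CharTwo.two_eq_zero (R := F))
    exact one_ne_zero this.2.1
  have hNtop : sqAdjoin γ₂ γ₃ ≠ ⊤ := fun htop => by
    have := hN 1 0 (htop ▸ Subfield.mem_top _)
    exact one_ne_zero this.1
  obtain ⟨G, κ', A, k, B, c, hκ', hA, hc, hG⟩ :=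
    exists_shear_of_hasTypeRS hψa hψt _ (sq_mem_sqAdjoin γ₂ γ₃) hNtop
  obtain ⟨r₀, r₁, hne, hval, hpol⟩ :=
    exists_pair_of_not_anisotropic h g hκ hg G hκ' _ hG
  exact no_quinVal_generic hγ hN hA k B c _ hc r₀ r₁ hne hval hpol
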